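/- arXiv:2603.26476 — 3 statements merged into one kernel-verified Lean document; each statement's English description precedes it below -/
import Mathlib

section
/- (Efficiency of the Shapley value.) For every nonempty finite player set P and every characteristic function v : Finset P → ℝ, the Shapley values sum to the total surplus: Σ_{k ∈ P} φ_k^Sh(v) = v(P) − v(∅). -/
/-- The Shapley value of player `k` in the cooperative game `v` on the finite player set `P`:
`φ_k(v) = Σ_{S ⊆ P \ {k}} ((|P|−|S|−1)!·|S|!/|P|!)·(v(S ∪ {k}) − v(S))`. -/
noncomputable def shapley {P : Type*} [Fintype P] [DecidableEq P]
    (v : Finset P → ℝ) (k : P) : ℝ :=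
  ∑ S ∈ (Finset.univ.erase k).powerset,
    (((Fintype.card P - S.card - 1).factorial * S.card.factorial : ℝ) /
      (Fintype.card P).factorial) * (v (insert k S) - v S)

/-- Reindexing the pairs `(k, S)` with `k ∉ S` by `(k, insert k S)`. -/
theorem sum_powerset_erase_insert {P M : Type*} [Fintype P] [DecidableEq P] [AddCommMonoid M]
    (f : Finset P → Finset P → M) :
    ∑ k : P, ∑ S ∈ (Finset.univ.erase k).powerset, f S (insert k S) =
      ∑ T : Finset P, ∑ k ∈ T, f (T.erase k) T := by
  rw [Finset.sum_sigma', Finset.sum_sigma']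
  refine Finset.sum_bij' (fun x _ => ⟨insert x.1 x.2, x.1⟩) (fun x _ => ⟨x.2, x.1.erase x.2⟩)
    ?_ ?_ ?_ ?_ ?_ <;>
  · rintro ⟨a, b⟩ h
    simp_all [Finset.subset_erase, Finset.insert_erase]

/-- Summing over the pairs `(k, S)` with `k ∉ S`, outer sum over `S`. -/
theorem sum_powerset_erase {P M : Type*} [Fintype P] [DecidableEq P] [AddCommMonoid M]
    (f : Finset P → M) :
    ∑ k : P, ∑ S ∈ (Finset.univ.erase k).powerset, f S =
      ∑ S : Finset P, (Fintype.card P - S.card) • f S := by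
  rw [Finset.sum_comm' (t' := Finset.univ) (s' := fun S => Sᶜ)
    (by simp [Finset.subset_erase])]
  simp [Finset.card_compl]

theorem shapley_efficiency {P : Type*} [Fintype P] [DecidableEq P] [Nonempty P]
    (v : Finset P → ℝ) :
    ∑ k : P, shapley v k = v Finset.univ - v ∅ := by
  set n := Fintype.card P with hn
  have hn0 : (n.factorial : ℝ) ≠ 0 := by positivity
  let g : Finset P → ℝ := fun T =>
    ((n - T.card).factorial * T.card.factorial : ℝ) / n.factorial * v T
  have gain : ∑ k : P, ∑ S ∈ (Finset.univ.erase k).powerset,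
      (((n - S.card - 1).factorial * S.card.factorial : ℝ) / n.factorial) * v (insert k S) =
      ∑ T : Finset P, g T - g ∅ := by
    rw [sum_powerset_erase_insert (fun S T =>
      (((n - S.card - 1).factorial * S.card.factorial : ℝ) / n.factorial) * v T),
      ← Finset.sum_erase_eq_sub (Finset.mem_univ _),
      ← Finset.sum_erase (a := ∅) Finset.univ (by simp)]
    refine Finset.sum_congr rfl fun T hT => ?_
    have hT0 : T.card ≠ 0 := by simpa using hT
    have hcongr : ∀ k ∈ T, (((n - (T.erase k).card - 1).factorial *
        (T.erase k).card.factorial : ℝ) / n.factorial) * v T =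
        (((n - T.card).factorial * (T.card - 1).factorial : ℝ) / n.factorial) * v T := by
      intro k hk
      rw [Finset.card_erase_of_mem hk, show n - (T.card - 1) - 1 = n - T.card by omega]
    rw [Finset.sum_congr rfl hcongr, Finset.sum_const, nsmul_eq_mul]
    simp only [g]
    rw [← Nat.mul_factorial_pred hT0]
    push_cast
    ring
  have loss : ∑ k : P, ∑ S ∈ (Finset.univ.erase k).powerset,
      (((n - S.card - 1).factorial * S.card.factorial : ℝ) / n.factorial) * v S =
      ∑ S : Finset P, g S - g Finset.univ := by
    rw [sum_powerset_erase (fun S =>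
      (((n - S.card - 1).factorial * S.card.factorial : ℝ) / n.factorial) * v S),
      ← Finset.sum_erase_eq_sub (Finset.mem_univ _),
      ← Finset.sum_erase (a := Finset.univ) Finset.univ (by simp)]
    refine Finset.sum_congr rfl fun S hS => ?_
    have hlt : S.card < n := Finset.card_lt_iff_ne_univ S |>.2 (by simpa using hS)
    simp only [g]
    rw [← hn, nsmul_eq_mul, ← Nat.mul_factorial_pred (Nat.sub_ne_zero_of_lt hlt)]
    push_cast
    ring
  have guniv : g Finset.univ = v Finset.univ := by simp [g, ← hn, hn0]
  have gempty : g ∅ = v ∅ := by simp [g, hn0]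
  simp only [shapley, mul_sub, Finset.sum_sub_distrib, ← hn]
  rw [gain, loss, guniv, gempty]
  ring
end

section
/- (Efficiency of ESL values.) Let P be a nonempty finite player set with |P| = a, let b₀, b₁, …, b_a be real coefficients with b_a = 1, and let v : Finset P → ℝ be any characteristic function. Then Σ_{g ∈ P} φ_g^ESL(v) = v(P) − b₀·v(∅); in particular, if b₀ = 0 or v(∅) = 0, then Σ_{g ∈ P} φ_g^ESL(v) = v(P). -/
/-- The ESL value of player `g` with coefficient sequence `b : ℕ → ℝ` in the game `v` on the
finite player set `P` with `|P| = a`: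
`φ_g(v) = Σ_{S ⊆ P \ {g}} ((a−|S|−1)!·|S|!/a!)·(b_{|S|+1}·v(S ∪ {g}) − b_{|S|}·v(S))`. -/
noncomputable def esl {P : Type*} [Fintype P] [DecidableEq P]
    (b : ℕ → ℝ) (v : Finset P → ℝ) (g : P) : ℝ :=
  ∑ S ∈ (Finset.univ.erase g).powerset,
    (((Fintype.card P - S.card - 1).factorial * S.card.factorial : ℝ) /
      (Fintype.card P).factorial) * (b (S.card + 1) * v (insert g S) - b S.card * v S)

theorem sum_sum_powerset_erase_insert {P M : Type*} [Fintype P] [DecidableEq P]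
    [AddCommMonoid M] (F : Finset P → M) :
    ∑ g : P, ∑ S ∈ (Finset.univ.erase g).powerset, F (insert g S) =
      ∑ T : Finset P, T.card • F T := by
  have key (g : P) : ∑ S ∈ (Finset.univ.erase g).powerset, F (insert g S) =
      ∑ T : Finset P with g ∈ T, F T := by
    refine Finset.sum_nbij' (fun S => insert g S) (fun T => T.erase g) ?_ ?_ ?_ ?_ ?_
    · simp
    · intro T _
      exact Finset.mem_powerset.2 (Finset.erase_subset_erase g (Finset.subset_univ T))
    · intro S hS
      exact Finset.erase_insert fun h => by simpa using Finset.mem_powerset.1 hS h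
    · intro T hT
      exact Finset.insert_erase (by simpa using hT)
    · simp
  simp_rw [key, ← Finset.sum_const]
  exact Finset.sum_comm' (by simp)

theorem sum_sum_powerset_erase {P M : Type*} [Fintype P] [DecidableEq P]
    [AddCommMonoid M] (F : Finset P → M) :
    ∑ g : P, ∑ S ∈ (Finset.univ.erase g).powerset, F S =
      ∑ S : Finset P, (Fintype.card P - S.card) • F S := by
  simp_rw [← Finset.card_compl, ← Finset.sum_const]
  refine Finset.sum_comm' fun g S => ?_
  simp [Finset.subset_erase]

theorem esl_efficiency {P : Type*} [Fintype P] [DecidableEq P] [Nonempty P]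
    (b : ℕ → ℝ) (hba : b (Fintype.card P) = 1) (v : Finset P → ℝ) :
    (∑ g : P, esl b v g = v Finset.univ - b 0 * v ∅) ∧
    (b 0 = 0 ∨ v ∅ = 0 → ∑ g : P, esl b v g = v Finset.univ) := by
  have total : ∑ g : P, esl b v g = v Finset.univ - b 0 * v ∅ := by
    set a := Fintype.card P with ha
    have hfac : (a.factorial : ℝ) ≠ 0 := by positivity
    have hpos : 0 < a := Fintype.card_pos
    let w : ℕ → ℝ := fun s => ((a - s - 1).factorial * s.factorial : ℝ) / a.factorial
    have split (g : P) : esl b v g =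
        ∑ S ∈ (Finset.univ.erase g).powerset,
          w ((insert g S).card - 1) * (b (insert g S).card * v (insert g S)) -
        ∑ S ∈ (Finset.univ.erase g).powerset, w S.card * (b S.card * v S) := by
      rw [esl, ← Finset.sum_sub_distrib]
      refine Finset.sum_congr rfl fun S hS => ?_
      have hg : g ∉ S := fun h => by simpa using Finset.mem_powerset.1 hS h
      rw [Finset.card_insert_of_notMem hg, Nat.add_sub_cancel, mul_sub]
    have coeff (T : Finset P) :
        T.card • (w (T.card - 1) * (b T.card * v T)) -
          (a - T.card) • (w T.card * (b T.card * v T)) =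
        (if T = Finset.univ then v T else 0) - (if T = ∅ then b 0 * v T else 0) := by
      have hle : T.card ≤ a := Finset.card_le_univ T
      have hempty : T = ∅ ↔ T.card = 0 := Finset.card_eq_zero.symm
      have huniv : T = Finset.univ ↔ T.card = a := (Finset.card_eq_iff_eq_univ T).symm
      rw [if_congr hempty rfl rfl, if_congr huniv rfl rfl]
      generalize v T = x
      generalize T.card = t at hle
      have lower (ht : 0 < t) : (t : ℝ) * w (t - 1) = (a - t).factorial * t.factorial /
          a.factorial := by
        have h : a - (t - 1) - 1 = a - t := by omega
        simp only [w, h, ← Nat.mul_factorial_pred ht.ne']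
        push_cast
        ring
      have upper (ht : t < a) : ((a - t : ℕ) : ℝ) * w t = (a - t).factorial * t.factorial /
          a.factorial := by
        simp only [w, ← Nat.mul_factorial_pred (Nat.sub_pos_of_lt ht).ne']
        push_cast
        ring
      simp only [nsmul_eq_mul, ← mul_assoc]
      rcases Nat.eq_zero_or_pos t with rfl | ht
      · rw [upper hpos]
        simp [hpos.ne, hfac]
      · rcases hle.eq_or_lt with rfl | hlt
        · rw [lower ht]
          simp [ht.ne', hfac, hba]
        · rw [lower ht, upper hlt]
          simp [ht.ne', hlt.ne]
    simp_rw [split]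
    rw [Finset.sum_sub_distrib,
      sum_sum_powerset_erase_insert fun T => w (T.card - 1) * (b T.card * v T),
      sum_sum_powerset_erase fun T => w T.card * (b T.card * v T),
      ← Finset.sum_sub_distrib, Finset.sum_congr rfl fun T _ => coeff T]
    simp
  refine ⟨total, fun h => ?_⟩
  rw [total, mul_eq_zero.2 h, sub_zero]
end

section
/- (Radzik's characterization of ESL values.) Let A be a finite set with |A| = a ≥ 2. A value is a map φ assigning to every game v : Finset A → ℝ with v(∅) = 0 a family of reals (φ_g(v))_{g ∈ A}. The value φ is efficient (Σ_{g ∈ A} φ_g(v) = v(A) for all such v), symmetric (for every permutation π of A and every such game v, φ_{π(g)}(π·v) = φ_g(v), where (π·v)(S) := v(π⁻¹(S))), and linear (for each g, the map v ↦ φ_g(v) is ℝ-linear on games with v(∅) = 0) if and only if there exists a unique sequence of a−1 real numbers b₁, …, b_{a−1} such that, setting b₀ = 0 and b_a = 1, for every g ∈ A and every game v with v(∅) = 0, φ_g(v) = Σ_{S ⊆ A \ {g}} ((a−|S|−1)!·|S|!/a!)·(b_{|S|+1}·v(S ∪ {g}) − b_{|S|}·v(S)). -/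
/-- The coefficient of `v T` in the ESL value of the player `g`. -/
noncomputable def eslCoeff {P : Type*} [Fintype P] [DecidableEq P]
    (b : ℕ → ℝ) (T : Finset P) (g : P) : ℝ :=
  if g ∈ T then
    (((Fintype.card P - T.card).factorial * (T.card - 1).factorial : ℝ) /
      (Fintype.card P).factorial) * b T.card
  else
    -((((Fintype.card P - T.card - 1).factorial * T.card.factorial : ℝ) /
      (Fintype.card P).factorial) * b T.card)

lemma esl_eq_sum_eslCoeff {P : Type*} [Fintype P] [DecidableEq P]
    (b : ℕ → ℝ) (v : Finset P → ℝ) (g : P) :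
    esl b v g = ∑ T : Finset P, eslCoeff b T g * v T := by
  have hu : (Finset.univ : Finset (Finset P)) = (insert g (Finset.univ.erase g)).powerset := by
    rw [Finset.insert_erase (Finset.mem_univ g), Finset.powerset_univ]
  rw [hu, Finset.sum_powerset_insert (Finset.notMem_erase g _), ← Finset.sum_add_distrib, esl]
  refine Finset.sum_congr rfl fun S hS => ?_
  have hg : g ∉ S := fun h => Finset.notMem_erase g _ (Finset.mem_powerset.1 hS h)
  simp only [eslCoeff, hg, if_false, Finset.mem_insert_self, if_true,
    Finset.card_insert_of_notMem hg, Nat.add_sub_cancel, Nat.sub_sub]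
  ring

lemma sum_eslCoeff {P : Type*} [Fintype P] [DecidableEq P] (b : ℕ → ℝ)
    (h0 : b 0 = 0) (h1 : b (Fintype.card P) = 1) (T : Finset P) :
    ∑ g : P, eslCoeff b T g = if T = Finset.univ then 1 else 0 := by
  have hP : Fintype.card P ≠ 0 := fun h => by rw [h, h0] at h1; exact zero_ne_one h1
  split_ifs with hT
  · subst hT
    obtain ⟨n, hn⟩ := Nat.exists_eq_succ_of_ne_zero hP
    simp only [eslCoeff, Finset.mem_univ, if_true, Finset.sum_const, Finset.card_univ, h1,
      nsmul_eq_mul]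
    rw [hn]
    simp only [Nat.sub_self, Nat.succ_sub_one, Nat.factorial_succ, Nat.factorial_zero,
      Nat.succ_eq_add_one]
    have := Nat.factorial_ne_zero n
    push_cast
    field_simp
  · have hlt : T.card < Fintype.card P := Finset.card_lt_iff_ne_univ T |>.2 hT
    obtain ht | ⟨t, ht⟩ : T.card = 0 ∨ ∃ t, T.card = t + 1 := by
      cases h : T.card with
      | zero => exact Or.inl rfl
      | succ t => exact Or.inr ⟨t, rfl⟩
    · simp [eslCoeff, ht, h0]
    · obtain ⟨m, hm⟩ : ∃ m, Fintype.card P = t + 1 + (m + 1) :=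
        ⟨Fintype.card P - (t + 1) - 1, by omega⟩
      have hc : (Finset.univ.filter fun g => g ∉ T).card = m + 1 := by
        have : (Finset.univ.filter fun g => g ∉ T) = Tᶜ := by ext; simp
        rw [this, Finset.card_compl]; omega
      simp only [eslCoeff, Finset.sum_ite, Finset.sum_const, hc, Finset.filter_univ_mem,
        nsmul_eq_mul]
      have e1 : Fintype.card P - (t + 1) = m + 1 := by omega
      rw [ht, e1]
      simp only [Nat.add_sub_cancel, Nat.factorial_succ]
      push_cast
      ring

lemma exists_perm_image_eq {P : Type*} [Fintype P] [DecidableEq P] {T T' : Finset P} {g g' : P}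
    (hc : T.card = T'.card) (hg : g ∈ T ↔ g' ∈ T') :
    ∃ π : Equiv.Perm P, T.image π = T' ∧ π g = g' := by
  let σ : Equiv.Perm P := (Finset.equivOfCardEq hc).extendSubtype
  have hσ : ∀ x, σ x ∈ T' ↔ x ∈ T := fun x =>
    ⟨fun h => by_contra fun hx => Equiv.extendSubtype_not_mem (Finset.equivOfCardEq hc) x hx h,
      fun h => Equiv.extendSubtype_mem (Finset.equivOfCardEq hc) x h⟩
  have hs : ∀ x, Equiv.swap (σ g) g' x ∈ T' ↔ x ∈ T' := fun x => by
    have := hσ g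
    rw [Equiv.swap_apply_def]
    split_ifs with h1 h2
    · subst h1; tauto
    · subst h2; tauto
    · rfl
  refine ⟨σ.trans (Equiv.swap (σ g) g'), Finset.eq_of_subset_of_card_le ?_ ?_, by simp⟩
  · intro y hy
    obtain ⟨x, hx, rfl⟩ := Finset.mem_image.1 hy
    exact (hs _).2 ((hσ x).2 hx)
  · rw [Finset.card_image_of_injective _ (Equiv.injective _), hc]

lemma eslCoeff_image {P : Type*} [Fintype P] [DecidableEq P] (b : ℕ → ℝ)
    (π : Equiv.Perm P) (T : Finset P) (g : P) :
    eslCoeff b (T.image π) (π g) = eslCoeff b T g := by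
  simp [eslCoeff, Finset.card_image_of_injective _ π.injective]

lemma esl_perm {P : Type*} [Fintype P] [DecidableEq P] (b : ℕ → ℝ)
    (π : Equiv.Perm P) (v : Finset P → ℝ) (g : P) :
    esl b (fun S => v (S.image π.symm)) (π g) = esl b v g := by
  rw [esl_eq_sum_eslCoeff, esl_eq_sum_eslCoeff]
  refine Finset.sum_bij' (fun T _ => T.image π.symm) (fun T _ => T.image π) (by simp) (by simp)
    (by simp [Finset.image_image]) (by simp [Finset.image_image]) fun T _ => ?_
  have h : (T.image π.symm).image π = T := by simp [Finset.image_image]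
  rw [← eslCoeff_image b π (T.image π.symm), h]

lemma sum_esl {P : Type*} [Fintype P] [DecidableEq P] (b : ℕ → ℝ)
    (h0 : b 0 = 0) (h1 : b (Fintype.card P) = 1) (v : Finset P → ℝ) :
    ∑ g : P, esl b v g = v Finset.univ := by
  simp only [esl_eq_sum_eslCoeff]
  rw [Finset.sum_comm]
  simp [← Finset.sum_mul, sum_eslCoeff b h0 h1]

lemma esl_linear {P : Type*} [Fintype P] [DecidableEq P] (b : ℕ → ℝ)
    (v w : Finset P → ℝ) (c d : ℝ) (g : P) :
    esl b (fun S => c * v S + d * w S) g = c * esl b v g + d * esl b w g := by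
  simp only [esl_eq_sum_eslCoeff, Finset.mul_sum, ← Finset.sum_add_distrib]
  exact Finset.sum_congr rfl fun T _ => by ring

/-- The game which is worth `1` on the coalition `T` and `0` on all others. -/
def diracGame {P : Type*} [DecidableEq P] (T : Finset P) : Finset P → ℝ :=
  fun S => if S = T then 1 else 0

lemma diracGame_empty {P : Type*} [DecidableEq P] {T : Finset P} (hT : T ≠ ∅) :
    diracGame T ∅ = 0 := if_neg hT.symm

lemma diracGame_image {P : Type*} [DecidableEq P] (π : Equiv.Perm P) (T : Finset P) :
    (fun S => diracGame T (S.image π.symm)) = diracGame (T.image π) := by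
  funext S
  have h : S.image π.symm = T ↔ S = T.image π := by
    constructor
    · rintro rfl; simp [Finset.image_image]
    · rintro rfl; simp [Finset.image_image]
  simp [diracGame, h]

lemma esl_diracGame {P : Type*} [Fintype P] [DecidableEq P] (b : ℕ → ℝ) (T : Finset P) (g : P) :
    esl b (diracGame T) g = eslCoeff b T g := by
  simp [esl_eq_sum_eslCoeff, diracGame]

/-- A value which is linear on games is determined by its values on Dirac games. -/
lemma eq_sum_diracGame {P : Type*} [Fintype P] [DecidableEq P] (ψ : (Finset P → ℝ) → ℝ)
    (hlin : ∀ v w : Finset P → ℝ, v ∅ = 0 → w ∅ = 0 → ∀ c d : ℝ,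
      ψ (fun S => c * v S + d * w S) = c * ψ v + d * ψ w)
    (v : Finset P → ℝ) (hv : v ∅ = 0) :
    ψ v = ∑ T ∈ Finset.univ.erase ∅, v T * ψ (diracGame T) := by
  have key : ∀ F : Finset (Finset P), ∅ ∉ F →
      ψ (fun S => ∑ T ∈ F, v T * diracGame T S) = ∑ T ∈ F, v T * ψ (diracGame T) := by
    intro F
    induction F using Finset.induction_on with
    | empty => intro _; simpa using hlin (fun _ => 0) (fun _ => 0) rfl rfl 0 0
    | insert T F hT ih =>
      intro hF
      simp only [Finset.mem_insert, not_or] at hF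
      have hz : ∑ U ∈ F, v U * diracGame U ∅ = 0 := Finset.sum_eq_zero fun U hU => by
        rw [diracGame_empty (fun h => hF.2 (h ▸ hU)), mul_zero]
      have := hlin (diracGame T) (fun S => ∑ U ∈ F, v U * diracGame U S)
        (diracGame_empty (Ne.symm hF.1)) hz (v T) 1
      simp only [one_mul] at this
      simp only [Finset.sum_insert hT]
      rw [this, ih hF.2]
  rw [← key _ (Finset.notMem_erase _ _)]
  congr 1
  funext S
  by_cases hS : S = ∅
  · subst hS
    rw [hv, Finset.sum_eq_zero fun U hU => by
      rw [diracGame_empty (Finset.ne_of_mem_erase hU), mul_zero]]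
  · simp [diracGame, hS]

lemma esl_congr_coeff {P : Type*} [Fintype P] [DecidableEq P] {b c : ℕ → ℝ}
    (h : ∀ T : Finset P, T ≠ ∅ → ∀ g, esl b (diracGame T) g = esl c (diracGame T) g)
    {s : ℕ} (h1 : 1 ≤ s) (h2 : s ≤ Fintype.card P) : b s = c s := by
  obtain ⟨T, -, rfl⟩ := Finset.exists_subset_card_eq (s := (Finset.univ : Finset P)) h2
  obtain ⟨g, hg⟩ := Finset.card_pos.1 h1
  have := h T (Finset.ne_empty_of_mem hg) g
  simp only [esl_diracGame, eslCoeff, hg, if_true] at this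
  exact mul_left_cancel₀ (by positivity) this

/-- Efficiency and symmetry determine a value on Dirac games up to an ESL coefficient sequence. -/
lemma exists_eslCoeff_eq {P : Type*} [Fintype P] [DecidableEq P] (hP : 0 < Fintype.card P)
    (ψ : Finset P → P → ℝ)
    (heff : ∀ T, T ≠ ∅ → ∑ g, ψ T g = if T = Finset.univ then 1 else 0)
    (hsymm : ∀ T T' : Finset P, T ≠ ∅ → ∀ g g', T.card = T'.card → (g ∈ T ↔ g' ∈ T') →
      ψ T g = ψ T' g') :
    ∃ b : ℕ → ℝ, (b 0 = 0 ∧ b (Fintype.card P) = 1 ∧ ∀ s, Fintype.card P < s → b s = 0) ∧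
      ∀ T, T ≠ ∅ → ∀ g, ψ T g = eslCoeff b T g := by
  classical
  let p : ℕ → ℝ := fun t =>
    if h : ∃ x : Finset P × P, x.1.card = t ∧ x.2 ∈ x.1 then ψ h.choose.1 h.choose.2 else 0
  have hp : ∀ (T : Finset P) (g : P), g ∈ T → ψ T g = p T.card := by
    intro T g hg
    have h : ∃ x : Finset P × P, x.1.card = T.card ∧ x.2 ∈ x.1 := ⟨(T, g), rfl, hg⟩
    simp only [p, dif_pos h]
    exact hsymm _ _ (Finset.ne_empty_of_mem hg) _ _ h.choose_spec.1.symm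
      (iff_of_true hg h.choose_spec.2)
  have hp0 : ∀ t, (t = 0 ∨ Fintype.card P < t) → p t = 0 := by
    intro t ht
    refine dif_neg ?_
    rintro ⟨x, rfl, hx⟩
    have h1 := Finset.card_pos.2 ⟨_, hx⟩
    have h2 := Finset.card_le_univ x.1
    omega
  let b : ℕ → ℝ := fun t => p t * ((Fintype.card P).factorial /
    ((Fintype.card P - t).factorial * (t - 1).factorial))
  have hmem : ∀ (T : Finset P) (g : P), g ∈ T → ψ T g = eslCoeff b T g := by
    intro T g hg
    simp only [eslCoeff, hg, if_true, b, hp T g hg]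
    have h1 := Nat.factorial_ne_zero (Fintype.card P)
    have h2 := Nat.factorial_ne_zero (Fintype.card P - T.card)
    have h3 := Nat.factorial_ne_zero (T.card - 1)
    field_simp
  have hb0 : b 0 = 0 := by simp [b, hp0 0 (Or.inl rfl)]
  have hb1 : b (Fintype.card P) = 1 := by
    have hne : (Finset.univ : Finset P) ≠ ∅ := by
      rw [← Finset.card_pos.trans Finset.nonempty_iff_ne_empty]; simpa using hP
    have h := heff _ hne
    rw [if_pos rfl, Finset.sum_congr rfl fun g _ => hp _ g (Finset.mem_univ g)] at h
    simp only [Finset.sum_const, Finset.card_univ, nsmul_eq_mul] at h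
    obtain ⟨n, hn⟩ := Nat.exists_eq_succ_of_ne_zero hP.ne'
    simp only [b]
    rw [hn] at h ⊢
    simp only [Nat.sub_self, Nat.succ_sub_one, Nat.factorial_succ, Nat.factorial_zero,
      Nat.succ_eq_add_one] at h ⊢
    have := Nat.factorial_ne_zero n
    push_cast at h ⊢
    field_simp
    linarith
  refine ⟨b, ⟨hb0, hb1, fun s hs => by simp [b, hp0 s (Or.inr hs)]⟩, fun T hT g => ?_⟩
  by_cases hg : g ∈ T
  · exact hmem T g hg
  · have h : ∑ x, ψ T x = ∑ x, eslCoeff b T x := by rw [heff T hT, sum_eslCoeff b hb0 hb1]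
    rw [← Finset.sum_add_sum_compl T, ← Finset.sum_add_sum_compl T (eslCoeff b T),
      Finset.sum_congr rfl fun x hx => hmem T x hx, add_right_inj,
      Finset.sum_congr rfl fun x hx => hsymm T T hT x g rfl
        (iff_of_false (Finset.mem_compl.1 hx) hg),
      Finset.sum_congr rfl fun x hx => show eslCoeff b T x = eslCoeff b T g by
        simp [eslCoeff, hg, Finset.mem_compl.1 hx]] at h
    simp only [Finset.sum_const, nsmul_eq_mul] at h
    refine mul_left_cancel₀ ?_ h
    exact Nat.cast_ne_zero.2 (Finset.card_ne_zero_of_mem (Finset.mem_compl.2 hg))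

/-- Radzik's characterization: a value on games with `v(∅) = 0` is efficient, symmetric and
linear iff it is given by an ESL formula for a unique coefficient sequence `b` (normalized so
that `b 0 = 0`, `b a = 1`, and `b s = 0` for `s > a`, which pins down exactly the free
coefficients `b₁, …, b_{a−1}`). -/
theorem radzik_characterization {A : Type*} [Fintype A] [DecidableEq A]
    (ha : 2 ≤ Fintype.card A)
    (φ : (Finset A → ℝ) → A → ℝ) :
    ((∀ v : Finset A → ℝ, v ∅ = 0 → ∑ g : A, φ v g = v Finset.univ) ∧
     (∀ π : Equiv.Perm A, ∀ v : Finset A → ℝ, v ∅ = 0 → ∀ g : A,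
        φ (fun S => v (S.image π.symm)) (π g) = φ v g) ∧
     (∀ g : A, ∀ v w : Finset A → ℝ, v ∅ = 0 → w ∅ = 0 → ∀ c d : ℝ,
        φ (fun S => c * v S + d * w S) g = c * φ v g + d * φ w g))
    ↔ (∃! b : ℕ → ℝ,
        (b 0 = 0 ∧ b (Fintype.card A) = 1 ∧ ∀ s : ℕ, Fintype.card A < s → b s = 0) ∧
        ∀ v : Finset A → ℝ, v ∅ = 0 → ∀ g : A, φ v g = esl b v g) := by
  constructor
  · rintro ⟨heff, hsymm, hlin⟩
    obtain ⟨b, hb, hφ⟩ := exists_eslCoeff_eq (by omega) (fun T => φ (diracGame T))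
      (fun T hT => by simpa [diracGame, eq_comm] using heff _ (diracGame_empty hT))
      (fun T T' hT g g' hc hg => by
        obtain ⟨π, rfl, rfl⟩ := exists_perm_image_eq hc hg
        simpa only [diracGame_image] using (hsymm π _ (diracGame_empty hT) g).symm)
    have hrep : ∀ v : Finset A → ℝ, v ∅ = 0 → ∀ g : A, φ v g = esl b v g := fun v hv g => by
      rw [eq_sum_diracGame (fun v => φ v g) (hlin g) v hv,
        eq_sum_diracGame (fun v => esl b v g) (fun v w _ _ c d => esl_linear b v w c d g) v hv]
      refine Finset.sum_congr rfl fun T hT => ?_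
      rw [esl_diracGame, ← hφ T (Finset.ne_of_mem_erase hT)]
    refine ⟨b, ⟨hb, hrep⟩, ?_⟩
    rintro c ⟨⟨hc0, -, hc2⟩, hc⟩
    funext s
    rcases Nat.eq_zero_or_pos s with rfl | hs
    · rw [hc0, hb.1]
    rcases lt_or_ge (Fintype.card A) s with h | h
    · rw [hc2 s h, hb.2.2 s h]
    · exact esl_congr_coeff (fun T hT g => by
        rw [← hc _ (diracGame_empty hT), hrep _ (diracGame_empty hT)]) hs h
  · rintro ⟨b, ⟨⟨h0, h1, -⟩, hφ⟩, -⟩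
    refine ⟨fun v hv => ?_, fun π v hv g => ?_, fun g v w hv hw c d => ?_⟩
    · rw [Finset.sum_congr rfl fun g _ => hφ v hv g, sum_esl b h0 h1]
    · rw [hφ v hv, hφ _ (by simpa using hv), esl_perm]
    · rw [hφ v hv, hφ w hw, hφ _ (by simp [hv, hw]), esl_linear]
end
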